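/- Let X ⊆ Y be finite subsets of ℝ^n and k ≥ 0 an integer with |X| ≥ k+1. Every vertex of L_{s,k}(X) is a vertex of L_{s,k}(Y), and the map Γ_k(X) → Γ_k(Y) sending (s, x) to (s, x) is order-preserving. For a ∈ Γ_k(X), let i_*(a) denote a maximal branch point of Γ_k(Y) below the image of a. Then for all branch points a, b of Γ_k(X): if u is a least upper bound of i_*(a) and i_*(b) in Γ_k(Y) and c is a least upper bound of a and b in Γ_k(X), then u ≼ i_*(c). -/

import Mathlib

open scoped Classical

noncomputable section

namespace DataHomotopy

/-- Points of `ℝ^n` with the Euclidean metric. -/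
abbrev Pt (n : ℕ) := EuclideanSpace ℝ (Fin n)

/-- `σ` is a simplex of the Vietoris–Rips complex `V_s(X)`: a nonempty subset of `X`
all of whose pairwise distances are at most `s`. -/
def IsVRSimplex {n : ℕ} (X : Finset (Pt n)) (s : ℝ) (σ : Finset (Pt n)) : Prop :=
  σ.Nonempty ∧ σ ⊆ X ∧ ∀ x ∈ σ, ∀ y ∈ σ, dist x y ≤ s

/-- `x` is a vertex of the Lesnick complex `L_{s,k}(X)`: `x ∈ X` and there are at least
`k` points of `X`, distinct from `x`, within distance `s` of `x`. -/
def IsLVertex {n : ℕ} (X : Finset (Pt n)) (k : ℕ) (s : ℝ) (x : Pt n) : Prop :=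
  x ∈ X ∧ ∃ S : Finset (Pt n), S ⊆ X ∧ x ∉ S ∧ k ≤ S.card ∧ ∀ x' ∈ S, dist x x' ≤ s

/-- `σ` is a simplex of the Lesnick complex `L_{s,k}(X)`: a Vietoris–Rips simplex all of
whose elements are vertices of `L_{s,k}(X)`. -/
def IsLSimplex {n : ℕ} (X : Finset (Pt n)) (k : ℕ) (s : ℝ) (σ : Finset (Pt n)) : Prop :=
  IsVRSimplex X s σ ∧ ∀ x ∈ σ, IsLVertex X k s x

/-- `x` and `y` lie in the same component of `L_{s,k}(X)`: both are vertices, and they are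
joined by a finite chain of vertices with consecutive distances at most `s`. -/
def SameComp {n : ℕ} (X : Finset (Pt n)) (k : ℕ) (s : ℝ) (x y : Pt n) : Prop :=
  IsLVertex X k s x ∧
    Relation.ReflTransGen (fun a b => IsLVertex X k s b ∧ dist a b ≤ s) x y

/-- `p = (s, x)` is an element of `Γ_k(X)`: `s ≥ 0` and `x` is a vertex of `L_{s,k}(X)`. -/
def InGamma {n : ℕ} (X : Finset (Pt n)) (k : ℕ) (p : ℝ × Pt n) : Prop :=
  0 ≤ p.1 ∧ IsLVertex X k p.1 p.2

/-- The preorder on `Γ_k(X)`: `(s, x) ≼ (t, y)` iff `s ≤ t` and `x`, `y` lie in the same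
component of `L_{t,k}(X)`. -/
def GammaLe {n : ℕ} (X : Finset (Pt n)) (k : ℕ) (p q : ℝ × Pt n) : Prop :=
  p.1 ≤ q.1 ∧ SameComp X k q.1 p.2 q.2

/-- `p = (t, x)` is a branch point of `Γ_k(X)`. -/
def IsBranch {n : ℕ} (X : Finset (Pt n)) (k : ℕ) (p : ℝ × Pt n) : Prop :=
  InGamma X k p ∧
    ((∃ s₀, s₀ < p.1 ∧ ∀ s, s₀ ≤ s → s < p.1 →
        ∃ x₀ x₁ : Pt n, IsLVertex X k s x₀ ∧ IsLVertex X k s x₁ ∧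
          ¬ SameComp X k s x₀ x₁ ∧ GammaLe X k (s, x₀) p ∧ GammaLe X k (s, x₁) p) ∨
      ¬ ∃ q : ℝ × Pt n, q.1 < p.1 ∧ InGamma X k q ∧ GammaLe X k q p)

/-- `c` is a least upper bound of `a` and `b` in `Γ_k(X)`. -/
def IsLUBIn {n : ℕ} (X : Finset (Pt n)) (k : ℕ) (a b c : ℝ × Pt n) : Prop :=
  InGamma X k c ∧ GammaLe X k a c ∧ GammaLe X k b c ∧
    ∀ c', InGamma X k c' → GammaLe X k a c' → GammaLe X k b c' → GammaLe X k c c'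

/-- `b` is a maximal branch point below `a` in `Γ_k(X)`. -/
def IsMaxBranchBelow {n : ℕ} (X : Finset (Pt n)) (k : ℕ) (b a : ℝ × Pt n) : Prop :=
  IsBranch X k b ∧ GammaLe X k b a ∧
    ∀ b', IsBranch X k b' → GammaLe X k b' a → GammaLe X k b' b

/-- The Euclidean distance on `(ℝ^n)^m ≅ ℝ^{nm}` between two `m`-tuples. -/
def tupleDist {n m : ℕ} (y x : Fin m → Pt n) : ℝ :=
  Real.sqrt (∑ i, dist (y i) (x i) ^ 2)

/-- `X^m_dis` is `r`-dense in `Y^m_dis`: every `m`-tuple of pairwise distinct points of `Y`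
is within distance `< r` (in `ℝ^{nm}`) of an `m`-tuple of pairwise distinct points of `X`. -/
def ConfigDense {n : ℕ} (X Y : Finset (Pt n)) (m : ℕ) (r : ℝ) : Prop :=
  ∀ y : Fin m → Pt n, (∀ i, y i ∈ Y) → Function.Injective y →
    ∃ x : Fin m → Pt n, (∀ i, x i ∈ X) ∧ Function.Injective x ∧ tupleDist y x < r

/-- `s` and `t` are consecutive phase-change numbers of `Y`: both are realized as distances
between points of `Y`, `s < t`, and no distance between points of `Y` lies strictly
between `s` and `t`. -/
def IsPhasePair {n : ℕ} (Y : Finset (Pt n)) (s t : ℝ) : Prop :=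
  (∃ a ∈ Y, ∃ b ∈ Y, dist a b = s) ∧ (∃ a ∈ Y, ∃ b ∈ Y, dist a b = t) ∧
    s < t ∧ ∀ a ∈ Y, ∀ b ∈ Y, dist a b ≤ s ∨ t ≤ dist a b

/-- `dS X k s x y = u - s`, where `u` is the least number `u ≥ s` such that `x` and `y`
lie in the same component of `L_{u,k}(X)`. -/
def dS {n : ℕ} (X : Finset (Pt n)) (k : ℕ) (s : ℝ) (x y : Pt n) : ℝ :=
  sInf {u : ℝ | s ≤ u ∧ SameComp X k u x y} - s

theorem IsLVertex.mono {n : ℕ} {X Y : Finset (Pt n)} (hXY : X ⊆ Y) {k : ℕ} {s t : ℝ}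
    (hst : s ≤ t) {x : Pt n} (h : IsLVertex X k s x) : IsLVertex Y k t x := by
  obtain ⟨hx, S, hS, hxS, hk, hd⟩ := h
  exact ⟨hXY hx, S, hS.trans hXY, hxS, hk, fun x' hx' => (hd x' hx').trans hst⟩

theorem SameComp.mono {n : ℕ} {X Y : Finset (Pt n)} (hXY : X ⊆ Y) {k : ℕ} {s t : ℝ}
    (hst : s ≤ t) {x y : Pt n} (h : SameComp X k s x y) : SameComp Y k t x y :=
  ⟨h.1.mono hXY hst,
    h.2.lift id fun _ _ hab => ⟨hab.1.mono hXY hst, hab.2.trans hst⟩⟩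

theorem GammaLe.mono {n : ℕ} {X Y : Finset (Pt n)} (hXY : X ⊆ Y) {k : ℕ} {p q : ℝ × Pt n}
    (h : GammaLe X k p q) : GammaLe Y k p q :=
  ⟨h.1, h.2.mono hXY le_rfl⟩

theorem GammaLe.trans {n : ℕ} {X : Finset (Pt n)} {k : ℕ} {p q r : ℝ × Pt n}
    (hpq : GammaLe X k p q) (hqr : GammaLe X k q r) : GammaLe X k p r := by
  have hpq' := hpq.2.mono subset_rfl hqr.1
  exact ⟨hpq.1.trans hqr.1, hpq'.1, hpq'.2.trans hqr.2.2⟩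

theorem stmt16 {n : ℕ} (X Y : Finset (Pt n)) (hXY : X ⊆ Y) (k : ℕ)
    (hcard : k + 1 ≤ X.card) :
    (∀ (s : ℝ) (x : Pt n), IsLVertex X k s x → IsLVertex Y k s x) ∧
    (∀ p q : ℝ × Pt n, GammaLe X k p q → GammaLe Y k p q) ∧
    (∀ a b c ia ib ic u : ℝ × Pt n,
      IsBranch X k a → IsBranch X k b →
      IsMaxBranchBelow Y k ia a → IsMaxBranchBelow Y k ib b →
      IsLUBIn Y k ia ib u → IsLUBIn X k a b c → IsMaxBranchBelow Y k ic c →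
      GammaLe Y k u ic) := by
  refine ⟨fun s x h => h.mono hXY le_rfl, fun p q h => h.mono hXY, ?_⟩
  intro a b c ia ib ic u _ _ hia hib hu hc hic
  exact hu.2.2.2 ic hic.1.1
    (hic.2.2 ia hia.1 (hia.2.1.trans (hc.2.1.mono hXY)))
    (hic.2.2 ib hib.1 (hib.2.1.trans (hc.2.2.1.mono hXY)))

end DataHomotopy
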